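/- Let n ≥ 2, σ ∈ (0,1), −2σ < α < 2σ and p > (n+α)/(n−2σ). Let u(x) = |x|^{−(2σ+α)/(p−1)} for x ∈ ℝⁿ\{0}. Then u ∈ C²(ℝⁿ\{0}) ∩ L_σ(ℝⁿ) and (−Δ)^σ u(x) = C_{p,σ,α}^{p−1} |x|^α u(x)^p for every x ∈ ℝⁿ\{0}; equivalently, the function C_{p,σ,α} |x|^{−(2σ+α)/(p−1)} solves (−Δ)^σ v = |x|^α v^p in ℝⁿ\{0}. -/

import Mathlib

open MeasureTheory Filter Metric Set
open scoped Topology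

noncomputable section

/-- The normalization constant `c_{n,σ}` of the fractional Laplacian. -/
def cns (n : ℕ) (σ : ℝ) : ℝ :=
  2 ^ (2 * σ) * σ * Real.Gamma (((n : ℝ) + 2 * σ) / 2) /
    (Real.pi ^ ((n : ℝ) / 2) * Real.Gamma (1 - σ))

/-- Membership in `L_σ(ℝⁿ)`: locally integrable with finite weighted integral. -/
def MemLsigma (n : ℕ) (σ : ℝ) (u : EuclideanSpace ℝ (Fin n) → ℝ) : Prop :=
  LocallyIntegrable u volume ∧
    Integrable (fun x => |u x| / (1 + ‖x‖) ^ ((n : ℝ) + 2 * σ)) volume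

/-- `(−Δ)^σ u = f` pointwise on `Ω`, in the principal value sense. -/
def FracLapEq (n : ℕ) (σ : ℝ) (u : EuclideanSpace ℝ (Fin n) → ℝ)
    (Ω : Set (EuclideanSpace ℝ (Fin n))) (f : EuclideanSpace ℝ (Fin n) → ℝ) : Prop :=
  ∀ x ∈ Ω, Tendsto (fun ε : ℝ =>
      cns n σ * ∫ ξ in {ξ : EuclideanSpace ℝ (Fin n) | ε < dist x ξ},
        (u x - u ξ) / dist x ξ ^ ((n : ℝ) + 2 * σ))
    (𝓝[>] (0 : ℝ)) (𝓝 (f x))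

/-- The function `Λ(τ)`. -/
def Lam (n : ℕ) (σ τ : ℝ) : ℝ :=
  2 ^ (2 * σ) *
    (Real.Gamma (((n : ℝ) + 2 * σ + 2 * τ) / 4) * Real.Gamma (((n : ℝ) + 2 * σ - 2 * τ) / 4)) /
    (Real.Gamma (((n : ℝ) - 2 * σ - 2 * τ) / 4) * Real.Gamma (((n : ℝ) - 2 * σ + 2 * τ) / 4))

/-- The constant `C_{p,σ,α} = Λ((n−2σ)/2 − (2σ+α)/(p−1))^{1/(p−1)}`. -/
def Cpsa (n : ℕ) (σ p α : ℝ) : ℝ :=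
  Lam n σ (((n : ℝ) - 2 * σ) / 2 - (2 * σ + α) / (p - 1)) ^ (1 / (p - 1))

lemma integrable_prod_of_nonneg {X Y : Type*} [MeasurableSpace X] [MeasurableSpace Y]
    {μ : Measure X} {ν : Measure Y} [SFinite μ] [SFinite ν] {f : X → Y → ℝ} {g : Y → ℝ}
    (hm : AEStronglyMeasurable (Function.uncurry f) (μ.prod ν))
    (h0 : ∀ᵐ y ∂ν, ∀ᵐ x ∂μ, 0 ≤ f x y) (hint : ∀ᵐ y ∂ν, Integrable (fun x => f x y) μ)
    (hval : ∀ᵐ y ∂ν, ∫ x, f x y ∂μ = g y) (hg : Integrable g ν) :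
    Integrable (Function.uncurry f) (μ.prod ν) := by
  rw [integrable_prod_iff' hm]
  refine ⟨hint, hg.congr ?_⟩
  filter_upwards [h0, hval] with y h1 h2
  rw [← h2]
  refine integral_congr_ae ?_
  filter_upwards [h1] with x hx
  simp [abs_of_nonneg hx]

lemma integral_rpow_mul_exp_neg_rate {s b : ℝ} (hs : 0 < s) (hb : 0 < b) :
    ∫ r in Ioi (0 : ℝ), r ^ (s - 1) * Real.exp (-(b * r)) = Real.Gamma s * b ^ (-s) := by
  rw [Real.integral_rpow_mul_exp_neg_mul_Ioi hs hb, one_div, Real.inv_rpow hb.le,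
    Real.rpow_neg hb.le, mul_comm]

lemma integrableOn_rpow_mul_exp_neg_rate {s b : ℝ} (hs : 0 < s) (hb : 0 < b) :
    IntegrableOn (fun r : ℝ => r ^ (s - 1) * Real.exp (-(b * r))) (Ioi 0) := by
  refine not_imp_comm.1 integral_undef ?_
  rw [integral_rpow_mul_exp_neg_rate hs hb]
  exact (mul_pos (Real.Gamma_pos_of_pos hs) (Real.rpow_pos_of_pos hb _)).ne'

/-- The beta integral of the second kind. -/
lemma betaPrime_integrable_and_integral {a b : ℝ} (ha : 0 < a) (hb : 0 < b) :
    IntegrableOn (fun v : ℝ => v ^ (a - 1) * (1 + v) ^ (-(a + b))) (Ioi 0) ∧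
      ∫ v in Ioi (0 : ℝ), v ^ (a - 1) * (1 + v) ^ (-(a + b)) =
        Real.Gamma a * Real.Gamma b / Real.Gamma (a + b) := by
  have hab : 0 < a + b := by positivity
  have hG := Real.Gamma_pos_of_pos hab
  let f : ℝ → ℝ → ℝ := fun v y =>
    v ^ (a - 1) * (y ^ (a + b - 1) * Real.exp (-((1 + v) * y)))
  have hfy : ∀ y : ℝ, 0 < y → ∀ v, f v y =
      y ^ (a + b - 1) * Real.exp (-y) * (v ^ (a - 1) * Real.exp (-(y * v))) := by
    intro y _ v
    simp only [f]
    rw [show -((1 + v) * y) = -y + -(y * v) by ring, Real.exp_add]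
    ring
  have hval : ∀ y : ℝ, 0 < y → ∫ v in Ioi (0 : ℝ), f v y =
      Real.Gamma a * (y ^ (b - 1) * Real.exp (-(1 * y))) := by
    intro y hy
    simp_rw [hfy y hy]
    rw [integral_const_mul, integral_rpow_mul_exp_neg_rate ha hy,
      show b - 1 = (a + b - 1) + -a by ring, Real.rpow_add hy]
    ring_nf
  have hI : Integrable (Function.uncurry f)
      ((volume.restrict (Ioi (0 : ℝ))).prod (volume.restrict (Ioi (0 : ℝ)))) := by
    refine integrable_prod_of_nonneg
      (g := fun y => Real.Gamma a * (y ^ (b - 1) * Real.exp (-(1 * y)))) ?_ ?_ ?_ ?_ ?_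
    · exact Measurable.aestronglyMeasurable (by unfold f Function.uncurry; fun_prop)
    · filter_upwards [ae_restrict_mem measurableSet_Ioi] with y (hy : 0 < y)
      filter_upwards [ae_restrict_mem measurableSet_Ioi] with v (hv : 0 < v)
      positivity
    · filter_upwards [ae_restrict_mem measurableSet_Ioi] with y (hy : 0 < y)
      simp_rw [hfy y hy]
      exact (integrableOn_rpow_mul_exp_neg_rate ha hy).const_mul _
    · filter_upwards [ae_restrict_mem measurableSet_Ioi] with y hy
      exact hval y hy
    · exact (integrableOn_rpow_mul_exp_neg_rate hb one_pos).const_mul _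
  have hv : ∀ v : ℝ, 0 < v → ∫ y in Ioi (0 : ℝ), f v y =
      Real.Gamma (a + b) * (v ^ (a - 1) * (1 + v) ^ (-(a + b))) := by
    intro v hv
    simp only [f]
    rw [integral_const_mul, integral_rpow_mul_exp_neg_rate hab (by positivity)]
    ring
  constructor
  · have h := hI.integral_prod_left.const_mul (Real.Gamma (a + b))⁻¹
    refine h.congr ?_
    filter_upwards [ae_restrict_mem measurableSet_Ioi] with v h0
    simp only [Function.uncurry_apply_pair]
    rw [hv v h0]
    field_simp
  · have h := integral_integral_swap hI
    rw [setIntegral_congr_fun measurableSet_Ioi hv,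
      setIntegral_congr_fun measurableSet_Ioi hval, integral_const_mul, integral_const_mul,
      integral_rpow_mul_exp_neg_rate hb one_pos] at h
    rw [eq_div_iff hG.ne', mul_comm, h]
    simp

lemma hasDerivAt_rpow_mul_one_sub {σ c v : ℝ} (hv : 0 < v) :
    HasDerivAt (fun v : ℝ => v ^ (-σ) * (1 - (1 + v) ^ (-c)))
      (c * (v ^ (1 - σ - 1) * (1 + v) ^ (-(1 - σ + (c + σ))))
        - σ * (v ^ (-σ - 1) * (1 - (1 + v) ^ (-c)))) v := by
  have h1 := Real.hasDerivAt_rpow_const (x := v) (p := -σ) (Or.inl hv.ne')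
  have h2 := ((hasDerivAt_id v).const_add 1).rpow_const (p := -c)
    (Or.inl (by simp only [id]; positivity))
  refine (h1.mul (h2.const_sub 1)).congr_deriv ?_
  simp only [id]
  rw [show 1 - σ - 1 = -σ by ring, show -(1 - σ + (c + σ)) = -c - 1 by ring]
  ring

lemma one_sub_one_add_rpow_le {c v : ℝ} (hc : 0 ≤ c) (hv : 0 ≤ v) :
    1 - (1 + v) ^ (-c) ≤ c * v := by
  have h := Real.add_one_le_exp (-c * Real.log (1 + v))
  rw [mul_comm, ← Real.rpow_def_of_pos (by positivity)] at h
  have h2 := Real.log_le_sub_one_of_pos (show 0 < 1 + v by positivity)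
  nlinarith [mul_le_mul_of_nonneg_left h2 hc]

lemma one_sub_one_add_rpow_nonneg {c v : ℝ} (hc : 0 ≤ c) (hv : 0 ≤ v) :
    0 ≤ 1 - (1 + v) ^ (-c) :=
  sub_nonneg.2 (Real.rpow_le_one_of_one_le_of_nonpos (by linarith) (by linarith))

lemma integrableOn_rpow_mul_one_sub {σ c : ℝ} (hσ : 0 < σ) (hσ1 : σ < 1) (hc : 0 ≤ c) :
    IntegrableOn (fun v : ℝ => v ^ (-σ - 1) * (1 - (1 + v) ^ (-c))) (Ioi 0) := by
  rw [← Ioc_union_Ioi_eq_Ioi (zero_le_one' ℝ)]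
  refine IntegrableOn.union ?_ ?_
  · have h : IntegrableOn (fun v : ℝ => c * v ^ (-σ)) (Ioc 0 1) := by
      rw [← intervalIntegrable_iff_integrableOn_Ioc_of_le zero_le_one]
      exact (intervalIntegral.intervalIntegrable_rpow' (by linarith)).const_mul c
    refine h.mono' (Measurable.aestronglyMeasurable (by fun_prop)) ?_
    filter_upwards [ae_restrict_mem measurableSet_Ioc] with v ⟨hv, _⟩
    rw [Real.norm_of_nonneg (mul_nonneg (by positivity) (one_sub_one_add_rpow_nonneg hc hv.le))]
    calc v ^ (-σ - 1) * (1 - (1 + v) ^ (-c)) ≤ v ^ (-σ - 1) * (c * v) :=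
          mul_le_mul_of_nonneg_left (one_sub_one_add_rpow_le hc hv.le) (by positivity)
      _ = c * v ^ (-σ) := by
          rw [Real.rpow_sub_one hv.ne']
          field_simp
  · have h : IntegrableOn (fun v : ℝ => v ^ (-σ - 1)) (Ioi 1) :=
      integrableOn_Ioi_rpow_of_lt (by linarith) one_pos
    refine h.mono' (Measurable.aestronglyMeasurable (by fun_prop)) ?_
    filter_upwards [ae_restrict_mem measurableSet_Ioi] with v (hv1 : 1 < v)
    have hv : 0 < v := by linarith
    rw [Real.norm_of_nonneg (mul_nonneg (by positivity) (one_sub_one_add_rpow_nonneg hc hv.le))]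
    refine mul_le_of_le_one_right (by positivity) ?_
    have : 0 ≤ (1 + v) ^ (-c) := by positivity
    linarith

lemma integral_rpow_mul_one_sub {σ c : ℝ} (hσ : 0 < σ) (hσ1 : σ < 1) (hc : 0 < c) :
    ∫ v in Ioi (0 : ℝ), v ^ (-σ - 1) * (1 - (1 + v) ^ (-c)) =
      Real.Gamma (1 - σ) * Real.Gamma (c + σ) / (σ * Real.Gamma c) := by
  obtain ⟨hb, hbv⟩ := betaPrime_integrable_and_integral (a := 1 - σ) (b := c + σ)
    (by linarith) (by linarith)
  have hJ := integrableOn_rpow_mul_one_sub hσ hσ1 hc.le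
  have h0 : ContinuousWithinAt (fun v : ℝ => v ^ (-σ) * (1 - (1 + v) ^ (-c))) (Ici 0) 0 := by
    have hz : (0 : ℝ) ^ (-σ) * (1 - (1 + 0) ^ (-c)) = 0 := by simp
    rw [ContinuousWithinAt, hz]
    have hlim : Tendsto (fun v : ℝ => c * v ^ (1 - σ)) (𝓝[≥] 0) (𝓝 0) := by
      have : ContinuousAt (fun v : ℝ => c * v ^ (1 - σ)) 0 :=
        (Real.continuousAt_rpow_const _ _ (Or.inr (by linarith))).const_mul c
      have h := this.tendsto.mono_left (nhdsWithin_le_nhds (s := Ici 0))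
      simpa [Real.zero_rpow (show 1 - σ ≠ 0 by linarith)] using h
    refine squeeze_zero' ?_ ?_ hlim
    · filter_upwards [self_mem_nhdsWithin] with v hv
      exact mul_nonneg (Real.rpow_nonneg hv _) (one_sub_one_add_rpow_nonneg hc.le hv)
    · filter_upwards [self_mem_nhdsWithin] with v (hv : 0 ≤ v)
      rcases hv.eq_or_lt with rfl | hv
      · simp [Real.zero_rpow (show 1 - σ ≠ 0 by linarith)]
      · calc v ^ (-σ) * (1 - (1 + v) ^ (-c)) ≤ v ^ (-σ) * (c * v) :=
              mul_le_mul_of_nonneg_left (one_sub_one_add_rpow_le hc.le hv.le) (by positivity)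
          _ = c * v ^ (1 - σ) := by
              rw [sub_eq_neg_add, Real.rpow_add_one hv.ne']
              ring
  have hinf : Tendsto (fun v : ℝ => v ^ (-σ) * (1 - (1 + v) ^ (-c))) atTop (𝓝 0) := by
    refine squeeze_zero' ?_ ?_ (tendsto_rpow_neg_atTop hσ)
    · filter_upwards [eventually_ge_atTop 0] with v hv
      exact mul_nonneg (Real.rpow_nonneg hv _) (one_sub_one_add_rpow_nonneg hc.le hv)
    · filter_upwards [eventually_ge_atTop 0] with v hv
      refine mul_le_of_le_one_right (by positivity) ?_
      have : 0 ≤ (1 + v) ^ (-c) := by positivity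
      linarith
  have hint := (hb.const_mul c).sub (hJ.const_mul σ)
  have h := integral_Ioi_of_hasDerivAt_of_tendsto h0
    (fun v hv => hasDerivAt_rpow_mul_one_sub (σ := σ) (c := c) hv) hint hinf
  rw [integral_sub (hb.const_mul c) (hJ.const_mul σ), integral_const_mul, integral_const_mul,
    hbv, show 1 - σ + (c + σ) = c + 1 by ring, Real.Gamma_add_one hc.ne'] at h
  have hG := Real.Gamma_pos_of_pos hc
  simp only [add_zero, Real.one_rpow, sub_self, mul_zero] at h
  rw [eq_div_iff (by positivity)]
  field_simp at h
  linarith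

/-- The difference of exponentials left after integrating out the space variable. -/
def heatDiff (N σ κ a r v : ℝ) : ℝ :=
  r ^ (σ + κ - 1) * (v ^ (κ - 1) *
    (Real.exp (-(a * v * r)) - (1 + v) ^ (-N) * Real.exp (-(a * (v / (1 + v)) * r))))

lemma integrable_heatDiff_and_integral {N σ κ a : ℝ} (hσ : 0 < σ) (hσ1 : σ < 1) (hκ : 0 < κ)
    (hN : σ + κ < N) (ha : 0 < a) :
    Integrable (Function.uncurry (heatDiff N σ κ a))
        ((volume.restrict (Ioi (0 : ℝ))).prod (volume.restrict (Ioi (0 : ℝ)))) ∧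
      ∫ r in Ioi (0 : ℝ), ∫ v in Ioi (0 : ℝ), heatDiff N σ κ a r v =
        Real.Gamma (σ + κ) * a ^ (-(σ + κ)) *
          (Real.Gamma (1 - σ) * Real.Gamma (N - κ) / (σ * Real.Gamma (N - (σ + κ)))) := by
  have hs : 0 < σ + κ := by positivity
  let J : ℝ → ℝ → ℝ := fun c v => v ^ (-σ - 1) * (1 - (1 + v) ^ (-c))
  let C : ℝ := Real.Gamma (σ + κ) * a ^ (-(σ + κ))
  let P : ℝ → ℝ → ℝ := fun r v => v ^ (κ - 1) * (1 - (1 + v) ^ (-N)) *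
    (r ^ (σ + κ - 1) * Real.exp (-(a * v * r)))
  let Q : ℝ → ℝ → ℝ := fun r v => v ^ (κ - 1) * (1 + v) ^ (-N) *
    (r ^ (σ + κ - 1) * Real.exp (-(a * (v / (1 + v)) * r)) -
      r ^ (σ + κ - 1) * Real.exp (-(a * v * r)))
  have hsplit : ∀ r v, heatDiff N σ κ a r v = P r v - Q r v := by
    intro r v
    simp only [heatDiff, P, Q]
    ring
  have hmul : ∀ v : ℝ, 0 < v → v ^ (κ - 1) * v ^ (-(σ + κ)) = v ^ (-σ - 1) := by
    intro v hv
    rw [← Real.rpow_add hv]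
    congr 1
    ring
  have hPi : ∀ v : ℝ, 0 < v → IntegrableOn (fun r => P r v) (Ioi 0) := fun v hv =>
    (integrableOn_rpow_mul_exp_neg_rate hs (mul_pos ha hv)).const_mul _
  have hPv : ∀ v : ℝ, 0 < v → ∫ r in Ioi (0 : ℝ), P r v = C * J N v := by
    intro v hv
    simp only [P, J, C]
    rw [integral_const_mul, integral_rpow_mul_exp_neg_rate hs (mul_pos ha hv),
      Real.mul_rpow ha.le hv.le, ← hmul v hv]
    ring
  have hQi : ∀ v : ℝ, 0 < v → IntegrableOn (fun r => Q r v) (Ioi 0) := fun v hv =>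
    ((integrableOn_rpow_mul_exp_neg_rate hs (b := a * (v / (1 + v))) (by positivity)).sub
      (integrableOn_rpow_mul_exp_neg_rate hs (mul_pos ha hv))).const_mul _
  have hQv : ∀ v : ℝ, 0 < v → ∫ r in Ioi (0 : ℝ), Q r v =
      C * (J N v - J (N - (σ + κ)) v) := by
    intro v hv
    have hv1 : 0 < 1 + v := by positivity
    simp only [Q, J, C]
    rw [integral_const_mul, integral_sub
      (integrableOn_rpow_mul_exp_neg_rate hs (b := a * (v / (1 + v))) (by positivity))
      (integrableOn_rpow_mul_exp_neg_rate hs (mul_pos ha hv)),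
      integral_rpow_mul_exp_neg_rate hs (b := a * (v / (1 + v))) (by positivity),
      integral_rpow_mul_exp_neg_rate hs (mul_pos ha hv),
      Real.mul_rpow ha.le hv.le, Real.mul_rpow ha.le (by positivity), ← hmul v hv,
      Real.div_rpow hv.le hv1.le, Real.rpow_neg hv1.le (σ + κ),
      show -(N - (σ + κ)) = -N + (σ + κ) by ring, Real.rpow_add hv1 (-N) (σ + κ)]
    have : 0 < (1 + v) ^ (σ + κ) := by positivity
    field_simp
    ring
  have hJ1 : IntegrableOn (J N) (Ioi 0) := integrableOn_rpow_mul_one_sub hσ hσ1 (by linarith)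
  have hJ2 : IntegrableOn (J (N - (σ + κ))) (Ioi 0) :=
    integrableOn_rpow_mul_one_sub hσ hσ1 (by linarith)
  have hP : Integrable (Function.uncurry P)
      ((volume.restrict (Ioi (0 : ℝ))).prod (volume.restrict (Ioi (0 : ℝ)))) := by
    refine integrable_prod_of_nonneg (g := fun v => C * J N v) ?_ ?_ ?_ ?_ (hJ1.const_mul _)
    · exact Measurable.aestronglyMeasurable (by unfold P Function.uncurry; fun_prop)
    · filter_upwards [ae_restrict_mem measurableSet_Ioi] with v (hv : 0 < v)
      filter_upwards [ae_restrict_mem measurableSet_Ioi] with r (hr : 0 < r)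
      have := one_sub_one_add_rpow_nonneg (c := N) (by linarith) hv.le
      positivity
    · filter_upwards [ae_restrict_mem measurableSet_Ioi] with v hv using hPi v hv
    · filter_upwards [ae_restrict_mem measurableSet_Ioi] with v hv using hPv v hv
  have hQ : Integrable (Function.uncurry Q)
      ((volume.restrict (Ioi (0 : ℝ))).prod (volume.restrict (Ioi (0 : ℝ)))) := by
    refine integrable_prod_of_nonneg (g := fun v => C * (J N v - J (N - (σ + κ)) v)) ?_ ?_ ?_ ?_
      ((hJ1.sub hJ2).const_mul _)
    · exact Measurable.aestronglyMeasurable (by unfold Q Function.uncurry; fun_prop)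
    · filter_upwards [ae_restrict_mem measurableSet_Ioi] with v (hv : 0 < v)
      filter_upwards [ae_restrict_mem measurableSet_Ioi] with r (hr : 0 < r)
      refine mul_nonneg (by positivity) ?_
      rw [← mul_sub]
      refine mul_nonneg (by positivity) (sub_nonneg.2 (Real.exp_le_exp.2 (neg_le_neg ?_)))
      have : v / (1 + v) ≤ v := div_le_self hv.le (by linarith)
      gcongr
    · filter_upwards [ae_restrict_mem measurableSet_Ioi] with v hv using hQi v hv
    · filter_upwards [ae_restrict_mem measurableSet_Ioi] with v hv using hQv v hv
  have hI : Integrable (Function.uncurry (heatDiff N σ κ a))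
      ((volume.restrict (Ioi (0 : ℝ))).prod (volume.restrict (Ioi (0 : ℝ)))) :=
    (hP.sub hQ).congr (ae_of_all _ fun z => (hsplit z.1 z.2).symm)
  refine ⟨hI, ?_⟩
  have hval : ∀ v : ℝ, v ∈ Ioi (0 : ℝ) → ∫ r in Ioi (0 : ℝ), heatDiff N σ κ a r v =
      C * J (N - (σ + κ)) v := by
    intro v hv
    simp_rw [hsplit]
    rw [integral_sub (hPi v hv) (hQi v hv), hPv v hv, hQv v hv]
    ring
  rw [integral_integral_swap hI, setIntegral_congr_fun measurableSet_Ioi hval,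
    integral_const_mul, integral_rpow_mul_one_sub hσ hσ1 (by linarith),
    show N - (σ + κ) + σ = N - κ by ring]

lemma integral_gaussian_shift {n : ℕ} {r t : ℝ} (hr : 0 < r) (ht : 0 < t)
    (x : EuclideanSpace ℝ (Fin n)) :
    (Integrable fun z : EuclideanSpace ℝ (Fin n) =>
        Real.exp (-(t * ‖x + z‖ ^ 2)) * Real.exp (-(r * ‖z‖ ^ 2))) ∧
      ∫ z : EuclideanSpace ℝ (Fin n),
        Real.exp (-(t * ‖x + z‖ ^ 2)) * Real.exp (-(r * ‖z‖ ^ 2)) =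
        (Real.pi / (r + t)) ^ ((n : ℝ) / 2) * Real.exp (-(r * t / (r + t) * ‖x‖ ^ 2)) := by
  have hrt : 0 < r + t := by positivity
  have key : ∀ z : EuclideanSpace ℝ (Fin n),
      Real.exp (-(t * ‖x + z‖ ^ 2)) * Real.exp (-(r * ‖z‖ ^ 2)) =
      Real.exp (-(r * t / (r + t) * ‖x‖ ^ 2)) *
        Real.exp (-(r + t) * ‖z + (t / (r + t)) • x‖ ^ 2) := by
    intro z
    rw [← Real.exp_add, ← Real.exp_add, norm_add_sq_real, norm_add_sq_real, norm_smul,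
      inner_smul_right, real_inner_comm, Real.norm_of_nonneg (by positivity)]
    congr 1
    field_simp
    ring
  have hval := GaussianFourier.integral_rexp_neg_mul_sq_norm
    (V := EuclideanSpace ℝ (Fin n)) hrt
  rw [finrank_euclideanSpace_fin] at hval
  have hint : Integrable fun z : EuclideanSpace ℝ (Fin n) =>
      Real.exp (-(r + t) * ‖z‖ ^ 2) := by
    refine not_imp_comm.1 integral_undef ?_
    rw [hval]
    positivity
  simp_rw [key]
  refine ⟨(hint.comp_add_right _).const_mul _, ?_⟩
  rw [integral_const_mul, integral_add_right_eq_self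
    (fun z : EuclideanSpace ℝ (Fin n) => Real.exp (-(r + t) * ‖z‖ ^ 2)), hval, mul_comm]

lemma integral_gaussian_norm_sq {n : ℕ} {r : ℝ} (hr : 0 < r) :
    (Integrable fun z : EuclideanSpace ℝ (Fin n) => Real.exp (-(r * ‖z‖ ^ 2))) ∧
      ∫ z : EuclideanSpace ℝ (Fin n), Real.exp (-(r * ‖z‖ ^ 2)) =
        (Real.pi / r) ^ ((n : ℝ) / 2) := by
  have hval := GaussianFourier.integral_rexp_neg_mul_sq_norm
    (V := EuclideanSpace ℝ (Fin n)) hr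
  rw [finrank_euclideanSpace_fin] at hval
  simp_rw [neg_mul] at hval
  refine ⟨not_imp_comm.1 integral_undef ?_, hval⟩
  rw [hval]
  positivity

lemma integral_rpow_norm_mul_gaussian {n : ℕ} {κ r : ℝ} (hκ : 0 < κ) (hn : κ < (n : ℝ) / 2)
    (hr : 0 < r) (x : EuclideanSpace ℝ (Fin n)) :
    (Integrable fun z : EuclideanSpace ℝ (Fin n) =>
        ‖x + z‖ ^ (-(2 * κ)) * Real.exp (-(r * ‖z‖ ^ 2))) ∧
      IntegrableOn (fun v : ℝ => v ^ (κ - 1) * ((1 + v) ^ (-((n : ℝ) / 2)) *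
        Real.exp (-(‖x‖ ^ 2 * (v / (1 + v)) * r)))) (Ioi 0) ∧
      ∫ z : EuclideanSpace ℝ (Fin n), ‖x + z‖ ^ (-(2 * κ)) * Real.exp (-(r * ‖z‖ ^ 2)) =
        r ^ κ / Real.Gamma κ * (Real.pi / r) ^ ((n : ℝ) / 2) *
          ∫ v in Ioi (0 : ℝ), v ^ (κ - 1) * ((1 + v) ^ (-((n : ℝ) / 2)) *
            Real.exp (-(‖x‖ ^ 2 * (v / (1 + v)) * r))) := by
  have hG := Real.Gamma_pos_of_pos hκ
  have : Nonempty (Fin n) := by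
    rw [← Fin.pos_iff_nonempty]
    have : (0 : ℝ) < n := by linarith
    exact_mod_cast this
  let N : ℝ := (n : ℝ) / 2
  let h : ℝ → ℝ := fun v => v ^ (κ - 1) * ((1 + v) ^ (-N) *
    Real.exp (-(‖x‖ ^ 2 * (v / (1 + v)) * r)))
  have hh : IntegrableOn h (Ioi 0) := by
    obtain ⟨hb, -⟩ := betaPrime_integrable_and_integral hκ (show 0 < N - κ by simp [N, hn])
    rw [show κ + (N - κ) = N by ring] at hb
    refine hb.mono' (Measurable.aestronglyMeasurable (by unfold h; fun_prop)) ?_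
    filter_upwards [ae_restrict_mem measurableSet_Ioi] with v (hv : 0 < v)
    rw [Real.norm_of_nonneg (by positivity)]
    refine mul_le_mul_of_nonneg_left (mul_le_of_le_one_right (by positivity) ?_) (by positivity)
    exact Real.exp_le_one_iff.2 (neg_nonpos.2 (by positivity))
  let g : EuclideanSpace ℝ (Fin n) → ℝ → ℝ := fun z v => v ^ (κ - 1) *
    (Real.exp (-(r * v * ‖x + z‖ ^ 2)) * Real.exp (-(r * ‖z‖ ^ 2)))
  have hgz : ∀ v : ℝ, 0 < v → ∫ z, g z v = (Real.pi / r) ^ N * h v := by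
    intro v hv
    simp only [g, h]
    rw [integral_const_mul, (integral_gaussian_shift hr (mul_pos hr hv) x).2,
      show r + r * v = r * (1 + v) by ring, ← div_div, Real.div_rpow (by positivity)
        (by positivity), Real.rpow_neg (by positivity) N,
      show r * (r * v) / (r * (1 + v)) * ‖x‖ ^ 2 = ‖x‖ ^ 2 * (v / (1 + v)) * r by field_simp]
    simp only [N]
    ring
  have hg : Integrable (Function.uncurry g)
      ((volume : Measure (EuclideanSpace ℝ (Fin n))).prod (volume.restrict (Ioi (0 : ℝ)))) := by
    refine integrable_prod_of_nonneg (g := fun v => (Real.pi / r) ^ N * h v) ?_ ?_ ?_ ?_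
      (hh.const_mul _)
    · exact Measurable.aestronglyMeasurable (by unfold g Function.uncurry; fun_prop)
    · filter_upwards [ae_restrict_mem measurableSet_Ioi] with v (hv : 0 < v)
      exact ae_of_all _ fun z => by positivity
    · filter_upwards [ae_restrict_mem measurableSet_Ioi] with v (hv : 0 < v)
      exact (integral_gaussian_shift hr (mul_pos hr hv) x).1.const_mul _
    · filter_upwards [ae_restrict_mem measurableSet_Ioi] with v (hv : 0 < v) using hgz v hv
  have hgv : ∀ᵐ z : EuclideanSpace ℝ (Fin n), ∫ v in Ioi (0 : ℝ), g z v =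
      Real.Gamma κ * r ^ (-κ) * (‖x + z‖ ^ (-(2 * κ)) * Real.exp (-(r * ‖z‖ ^ 2))) := by
    have hne : ∀ᵐ z : EuclideanSpace ℝ (Fin n), z ≠ -x := by
      simp [ae_iff]
    filter_upwards [hne] with z hz
    have hp : 0 < ‖x + z‖ := norm_pos_iff.2 fun h0 => hz (eq_neg_of_add_eq_zero_right h0)
    have hcongr : ∀ v : ℝ, g z v = Real.exp (-(r * ‖z‖ ^ 2)) *
        (v ^ (κ - 1) * Real.exp (-(r * ‖x + z‖ ^ 2 * v))) := by
      intro v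
      simp only [g]
      rw [show r * v * ‖x + z‖ ^ 2 = r * ‖x + z‖ ^ 2 * v by ring]
      ring
    simp_rw [hcongr]
    rw [integral_const_mul, integral_rpow_mul_exp_neg_rate hκ (by positivity),
      Real.mul_rpow hr.le (by positivity), ← Real.rpow_natCast ‖x + z‖ 2, ← Real.rpow_mul hp.le]
    rw [show ((2 : ℕ) : ℝ) * -κ = -(2 * κ) by push_cast; ring]
    ring
  have hrk : r ^ κ * r ^ (-κ) = 1 := by
    rw [← Real.rpow_add hr]
    simp
  have hrk0 : 0 < r ^ (-κ) := by positivity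
  refine ⟨?_, hh, ?_⟩
  · have hi := hg.integral_prod_left.const_mul (Real.Gamma κ * r ^ (-κ))⁻¹
    refine hi.congr ?_
    filter_upwards [hgv] with z hz
    simp only [Function.uncurry_apply_pair]
    rw [hz]
    field_simp
  · have hs := integral_integral_swap hg
    rw [integral_congr_ae hgv, setIntegral_congr_fun measurableSet_Ioi hgz, integral_const_mul,
      integral_const_mul] at hs
    change _ = r ^ κ / Real.Gamma κ * (Real.pi / r) ^ N * ∫ v in Ioi (0 : ℝ), h v
    rw [mul_assoc, ← hs]
    field_simp
    linear_combination (-(∫ z : EuclideanSpace ℝ (Fin n),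
      ‖x + z‖ ^ (-(2 * κ)) * Real.exp (-(r * ‖z‖ ^ 2)))) * hrk

lemma gamma_mul_integral_div_rpow {n : ℕ} {β : ℝ} (hβ : 0 < β) [Nonempty (Fin n)]
    {E : EuclideanSpace ℝ (Fin n) → ℝ} (hm : Measurable E)
    (hE : Integrable fun z => E z / ‖z‖ ^ (2 * β)) :
    Real.Gamma β * ∫ z, E z / ‖z‖ ^ (2 * β) =
      ∫ r in Ioi (0 : ℝ), r ^ (β - 1) * ∫ z, E z * Real.exp (-(r * ‖z‖ ^ 2)) := by
  have hG := Real.Gamma_pos_of_pos hβ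
  let g : EuclideanSpace ℝ (Fin n) → ℝ → ℝ := fun z r =>
    E z * (r ^ (β - 1) * Real.exp (-(‖z‖ ^ 2 * r)))
  have hne : ∀ᵐ z : EuclideanSpace ℝ (Fin n), z ≠ 0 := by simp [ae_iff]
  have hpow : ∀ z : EuclideanSpace ℝ (Fin n), z ≠ 0 →
      (‖z‖ ^ 2) ^ (-β) = (‖z‖ ^ (2 * β))⁻¹ := by
    intro z hz
    rw [← Real.rpow_natCast ‖z‖ 2, ← Real.rpow_mul (norm_nonneg _), ← Real.rpow_neg (norm_nonneg _)]
    congr 1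
    push_cast
    ring
  have hgi : Integrable (Function.uncurry g) (volume.prod (volume.restrict (Ioi (0 : ℝ)))) := by
    rw [integrable_prod_iff]
    · constructor
      · filter_upwards [hne] with z hz
        have hz := norm_pos_iff.2 hz
        exact (integrableOn_rpow_mul_exp_neg_rate hβ (b := ‖z‖ ^ 2) (by positivity)).const_mul
          (E z)
      · refine (hE.norm.const_mul (Real.Gamma β)).congr ?_
        filter_upwards [hne] with z hz
        have hz0 := norm_pos_iff.2 hz
        have h1 : ∀ r ∈ Ioi (0 : ℝ), ‖Function.uncurry g (z, r)‖ =
            |E z| * (r ^ (β - 1) * Real.exp (-(‖z‖ ^ 2 * r))) := by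
          intro r (hr : 0 < r)
          simp only [Function.uncurry_apply_pair, g]
          rw [Real.norm_eq_abs, abs_mul, abs_of_nonneg (a := r ^ (β - 1) * _) (by positivity)]
        rw [setIntegral_congr_fun measurableSet_Ioi h1, integral_const_mul,
          integral_rpow_mul_exp_neg_rate hβ (by positivity), hpow z hz, norm_div,
          Real.norm_eq_abs, Real.norm_of_nonneg (by positivity)]
        ring
    · exact Measurable.aestronglyMeasurable (by unfold g Function.uncurry; fun_prop)
  have hs := integral_integral_swap hgi
  have hz : ∀ᵐ z : EuclideanSpace ℝ (Fin n), ∫ r in Ioi (0 : ℝ), g z r =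
      Real.Gamma β * (E z / ‖z‖ ^ (2 * β)) := by
    filter_upwards [hne] with z hz
    have hz0 := norm_pos_iff.2 hz
    simp only [g]
    rw [integral_const_mul, integral_rpow_mul_exp_neg_rate hβ (by positivity), hpow z hz]
    ring
  rw [integral_congr_ae hz, integral_const_mul] at hs
  rw [hs]
  refine setIntegral_congr_fun measurableSet_Ioi fun r _ => ?_
  simp only [g]
  rw [← integral_const_mul]
  refine integral_congr_ae (ae_of_all _ fun z => ?_)
  simp only
  rw [mul_comm r]
  ring

/-- The amount by which `f x` exceeds the mean of `f (x + z)` and `f (x - z)`. -/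
def meanDefect {V : Type*} [AddCommGroup V] (f : V → ℝ) (x z : V) : ℝ :=
  f x - (f (x + z) + f (x - z)) / 2

lemma integral_meanDefect_mul_even {n : ℕ} {f k : EuclideanSpace ℝ (Fin n) → ℝ}
    {x : EuclideanSpace ℝ (Fin n)} (hk : ∀ z, k (-z) = k z) (hki : Integrable k)
    (hf : Integrable fun z => f (x + z) * k z) :
    ∫ z, meanDefect f x z * k z = f x * (∫ z, k z) - ∫ z, f (x + z) * k z := by
  have hf' : Integrable fun z => f (x - z) * k z := by
    simpa [hk, ← sub_eq_add_neg] using hf.comp_neg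
  have heq : ∫ z, f (x - z) * k z = ∫ z, f (x + z) * k z := by
    rw [← integral_neg_eq_self]
    simp [hk]
  have hsplit : ∀ z, meanDefect f x z * k z =
      f x * k z - (1 / 2 * (f (x + z) * k z) + 1 / 2 * (f (x - z) * k z)) := by
    intro z
    unfold meanDefect
    ring
  simp_rw [hsplit]
  have hadd : Integrable fun z => 1 / 2 * (f (x + z) * k z) + 1 / 2 * (f (x - z) * k z) :=
    (hf.const_mul _).add (hf'.const_mul _)
  rw [integral_sub (hki.const_mul _) hadd,
    integral_add (hf.const_mul _) (hf'.const_mul _), integral_const_mul, integral_const_mul,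
    integral_const_mul, heq]
  ring

lemma integral_meanDefect_rpow_norm_mul_gaussian {n : ℕ} {σ κ r : ℝ} (hκ : 0 < κ)
    (hn : κ < (n : ℝ) / 2) (hr : 0 < r) {x : EuclideanSpace ℝ (Fin n)} (hx : x ≠ 0) :
    r ^ ((n : ℝ) / 2 + σ - 1) * ∫ z, meanDefect (fun y => ‖y‖ ^ (-(2 * κ))) x z *
        Real.exp (-(r * ‖z‖ ^ 2)) =
      Real.pi ^ ((n : ℝ) / 2) / Real.Gamma κ *
        ∫ v in Ioi (0 : ℝ), heatDiff ((n : ℝ) / 2) σ κ (‖x‖ ^ 2) r v := by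
  have hx0 := norm_pos_iff.2 hx
  have hG := Real.Gamma_pos_of_pos hκ
  obtain ⟨hi, hv, hval⟩ := integral_rpow_norm_mul_gaussian hκ hn hr x
  obtain ⟨hgi, hgv⟩ := integral_gaussian_norm_sq (n := n) hr
  have hxκ : (‖x‖ ^ 2) ^ (-κ) = ‖x‖ ^ (-(2 * κ)) := by
    rw [← Real.rpow_natCast ‖x‖ 2, ← Real.rpow_mul hx0.le]
    congr 1
    push_cast
    ring
  have hrate : 0 < ‖x‖ ^ 2 * r := by positivity
  have h1 := integrableOn_rpow_mul_exp_neg_rate hκ hrate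
  have h1v := integral_rpow_mul_exp_neg_rate hκ hrate
  rw [integral_meanDefect_mul_even (by simp) hgi hi, hgv, hval]
  have hD : ∀ v : ℝ, heatDiff ((n : ℝ) / 2) σ κ (‖x‖ ^ 2) r v = r ^ (σ + κ - 1) *
      (v ^ (κ - 1) * Real.exp (-(‖x‖ ^ 2 * r * v)) -
        v ^ (κ - 1) * ((1 + v) ^ (-((n : ℝ) / 2)) *
          Real.exp (-(‖x‖ ^ 2 * (v / (1 + v)) * r)))) := by
    intro v
    unfold heatDiff
    rw [show ‖x‖ ^ 2 * r * v = ‖x‖ ^ 2 * v * r by ring]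
    ring
  simp_rw [hD]
  rw [integral_const_mul, integral_sub h1 hv, h1v, Real.div_rpow Real.pi_pos.le hr.le,
    Real.mul_rpow (by positivity) hr.le, hxκ,
    show (n : ℝ) / 2 + σ - 1 = (n : ℝ) / 2 + (σ - 1) by ring,
    show σ + κ - 1 = κ + (σ - 1) by ring, Real.rpow_add hr, Real.rpow_add hr,
    Real.rpow_neg hr.le]
  generalize (∫ v in Ioi (0 : ℝ), v ^ (κ - 1) * ((1 + v) ^ (-((n : ℝ) / 2)) *
    Real.exp (-(‖x‖ ^ 2 * (v / (1 + v)) * r)))) = I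
  field_simp

lemma integral_meanDefect_rpow_norm {n : ℕ} {σ κ : ℝ} (hσ : 0 < σ) (hσ1 : σ < 1) (hκ : 0 < κ)
    (hn : σ + κ < (n : ℝ) / 2) {x : EuclideanSpace ℝ (Fin n)} (hx : x ≠ 0)
    (hE : Integrable fun z =>
      meanDefect (fun y : EuclideanSpace ℝ (Fin n) => ‖y‖ ^ (-(2 * κ))) x z /
        ‖z‖ ^ ((n : ℝ) + 2 * σ)) :
    Real.Gamma ((n : ℝ) / 2 + σ) *
        ∫ z, meanDefect (fun y : EuclideanSpace ℝ (Fin n) => ‖y‖ ^ (-(2 * κ))) x z /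
          ‖z‖ ^ ((n : ℝ) + 2 * σ) =
      Real.pi ^ ((n : ℝ) / 2) / Real.Gamma κ *
        (Real.Gamma (σ + κ) * ‖x‖ ^ (-(2 * (σ + κ))) *
          (Real.Gamma (1 - σ) * Real.Gamma ((n : ℝ) / 2 - κ) /
            (σ * Real.Gamma ((n : ℝ) / 2 - (σ + κ))))) := by
  have hx0 := norm_pos_iff.2 hx
  have : Nonempty (Fin n) := by
    rw [← Fin.pos_iff_nonempty]
    have : (0 : ℝ) < n := by linarith
    exact_mod_cast this
  rw [show (n : ℝ) + 2 * σ = 2 * ((n : ℝ) / 2 + σ) by ring] at hE ⊢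
  rw [gamma_mul_integral_div_rpow (by linarith) (by unfold meanDefect; fun_prop) hE,
    setIntegral_congr_fun measurableSet_Ioi fun r hr =>
      integral_meanDefect_rpow_norm_mul_gaussian (σ := σ) hκ (by linarith) hr hx,
    integral_const_mul,
    (integrable_heatDiff_and_integral hσ hσ1 hκ hn (a := ‖x‖ ^ 2) (by positivity)).2,
    ← Real.rpow_natCast ‖x‖ 2, ← Real.rpow_mul hx0.le,
    show ((2 : ℕ) : ℝ) * -(σ + κ) = -(2 * (σ + κ)) by push_cast; ring]

lemma integrable_weighted_rpow_norm {n : ℕ} {σ κ : ℝ} (hσ : 0 < σ) (hκ : 0 < κ)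
    (hn : 2 * κ < n) [Nonempty (Fin n)] :
    Integrable fun x : EuclideanSpace ℝ (Fin n) =>
      |‖x‖ ^ (-(2 * κ))| / (1 + ‖x‖) ^ ((n : ℝ) + 2 * σ) := by
  have h := (integrable_fun_norm_addHaar (volume : Measure (EuclideanSpace ℝ (Fin n)))
    (f := fun y : ℝ => |y ^ (-(2 * κ))| / (1 + y) ^ ((n : ℝ) + 2 * σ))).2
  refine h ?_
  rw [finrank_euclideanSpace_fin]
  refine (betaPrime_integrable_and_integral (a := n - 2 * κ) (b := 2 * σ + 2 * κ)
    (by linarith) (by linarith)).1.congr_fun (fun y (hy : 0 < y) => ?_) measurableSet_Ioi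
  have hn1 : 1 ≤ n := Fin.pos_iff_nonempty.2 ‹_›
  simp only [smul_eq_mul]
  rw [abs_of_nonneg (by positivity), ← Real.rpow_natCast y (n - 1), Nat.cast_sub hn1, div_eq_mul_inv,
    ← Real.rpow_neg (by positivity), ← mul_assoc, ← Real.rpow_add hy]
  congr 2
  · push_cast
    ring
  · ring

lemma locallyIntegrable_of_integrable_weighted {n : ℕ} {γ : ℝ}
    {f : EuclideanSpace ℝ (Fin n) → ℝ} (hm : Measurable f)
    (hf : Integrable fun x => |f x| / (1 + ‖x‖) ^ γ) : LocallyIntegrable f := by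
  rw [locallyIntegrable_iff]
  intro K hK
  have hc : Continuous fun x : EuclideanSpace ℝ (Fin n) => (1 + ‖x‖) ^ γ :=
    (continuous_const.add continuous_norm).rpow_const fun x =>
      Or.inl (show 1 + ‖x‖ ≠ 0 by positivity)
  refine (hf.integrableOn.mul_continuousOn hc.continuousOn hK).mono'
    hm.aestronglyMeasurable (ae_of_all _ fun x => ?_)
  have : 0 < (1 + ‖x‖) ^ γ := by positivity
  rw [Real.norm_eq_abs, div_mul_cancel₀ _ this.ne']

lemma integrableOn_shift_div_rpow {n : ℕ} {γ ε : ℝ} (hγ : 0 < γ) (hε : 0 < ε)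
    {f : EuclideanSpace ℝ (Fin n) → ℝ} (hm : Measurable f)
    (hf : Integrable fun x => |f x| / (1 + ‖x‖) ^ γ) (x : EuclideanSpace ℝ (Fin n)) :
    IntegrableOn (fun z => f (x + z) / ‖z‖ ^ γ) {z | ε < ‖z‖} := by
  have hset : MeasurableSet {z : EuclideanSpace ℝ (Fin n) | ε < ‖z‖} :=
    measurableSet_lt measurable_const measurable_norm
  let C : ℝ := (1 + ‖x‖) / ε + 1
  have hC : 0 < C := by positivity
  refine ((hf.comp_add_left x).integrableOn.const_mul (C ^ γ)).mono'
    (Measurable.aestronglyMeasurable (by fun_prop)) ?_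
  filter_upwards [ae_restrict_mem hset] with z (hz : ε < ‖z‖)
  have hz0 : 0 < ‖z‖ := hε.trans hz
  have hle : 1 + ‖x + z‖ ≤ C * ‖z‖ := by
    have h1 : (1 + ‖x‖) / ε * ε ≤ (1 + ‖x‖) / ε * ‖z‖ := by gcongr
    rw [div_mul_cancel₀ _ hε.ne'] at h1
    have h2 := norm_add_le x z
    simp only [C]
    linarith
  have hpow : (1 + ‖x + z‖) ^ γ ≤ C ^ γ * ‖z‖ ^ γ := by
    rw [← Real.mul_rpow hC.le hz0.le]
    exact Real.rpow_le_rpow (by positivity) hle hγ.le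
  rw [norm_div, Real.norm_eq_abs, Real.norm_of_nonneg (by positivity), mul_div_assoc',
    div_le_div_iff₀ (by positivity) (by positivity)]
  calc |f (x + z)| * (1 + ‖x + z‖) ^ γ ≤ |f (x + z)| * (C ^ γ * ‖z‖ ^ γ) := by gcongr
    _ = C ^ γ * |f (x + z)| * ‖z‖ ^ γ := by ring

lemma integrableOn_inv_rpow_norm {n : ℕ} {γ ε : ℝ} (hγ : (n : ℝ) < γ) (hε : 0 < ε) :
    IntegrableOn (fun z : EuclideanSpace ℝ (Fin n) => (‖z‖ ^ γ)⁻¹) {z | ε < ‖z‖} := by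
  have hw : Integrable fun x : EuclideanSpace ℝ (Fin n) => |(1 : ℝ)| / (1 + ‖x‖) ^ γ := by
    have h := integrable_one_add_norm (E := EuclideanSpace ℝ (Fin n)) (μ := volume) (r := γ)
      (by rwa [finrank_euclideanSpace_fin])
    refine h.congr (ae_of_all _ fun x => ?_)
    simp only [abs_one]
    rw [Real.rpow_neg (by positivity), one_div]
  simpa using integrableOn_shift_div_rpow (lt_of_le_of_lt n.cast_nonneg hγ) hε
    (f := fun _ => (1 : ℝ)) measurable_const hw 0

lemma exists_abs_meanDefect_le {V : Type*} [NormedAddCommGroup V] [NormedSpace ℝ V] {f : V → ℝ}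
    {x : V} (hf : ContDiffAt ℝ 2 f x) :
    ∃ K δ : ℝ, 0 < δ ∧ ∀ z, ‖z‖ < δ → |meanDefect f x z| ≤ K * ‖z‖ ^ 2 := by
  obtain ⟨K, t, ht, hK⟩ := (hf.fderiv_right (m := 1) (by norm_num)).exists_lipschitzOnWith
  have hd : ∀ᶠ y in 𝓝 x, DifferentiableAt ℝ f y :=
    (hf.eventually (by norm_num)).mono fun y hy => hy.differentiableAt (by norm_num)
  obtain ⟨δ, hδ, hball⟩ := Metric.mem_nhds_iff.1 (Filter.inter_mem ht hd)
  refine ⟨K, δ, hδ, fun z hz => ?_⟩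
  let g : V → ℝ := fun w => f (x + w) + f (x - w)
  have hmem : ∀ w : V, ‖w‖ ≤ ‖z‖ → x + w ∈ ball x δ ∧ x - w ∈ ball x δ := by
    intro w hw
    simp only [mem_ball, dist_eq_norm, add_sub_cancel_left, sub_sub_cancel_left, norm_neg]
    exact ⟨hw.trans_lt hz, hw.trans_lt hz⟩
  have hg : ∀ w ∈ closedBall (0 : V) ‖z‖, HasFDerivWithinAt g
      (fderiv ℝ f (x + w) - fderiv ℝ f (x - w)) (closedBall 0 ‖z‖) w := by
    intro w hw
    obtain ⟨h1, h2⟩ := hmem w (by simpa using hw)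
    have d1 := ((hball h1).2 : DifferentiableAt ℝ f (x + w)).hasFDerivAt.comp w
      ((hasFDerivAt_id w).const_add x)
    have d2 := ((hball h2).2 : DifferentiableAt ℝ f (x - w)).hasFDerivAt.comp w
      ((hasFDerivAt_id w).const_sub x)
    refine ((d1.add d2).congr_fderiv ?_).hasFDerivWithinAt
    ext v
    simp [sub_eq_add_neg]
  have hb : ∀ w ∈ closedBall (0 : V) ‖z‖,
      ‖fderiv ℝ f (x + w) - fderiv ℝ f (x - w)‖ ≤ K * (2 * ‖z‖) := by
    intro w hw
    have hw' : ‖w‖ ≤ ‖z‖ := by simpa using hw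
    obtain ⟨h1, h2⟩ := hmem w hw'
    have h := hK.dist_le_mul _ (hball h1).1 _ (hball h2).1
    rw [dist_eq_norm, dist_eq_norm] at h
    refine h.trans (mul_le_mul_of_nonneg_left ?_ K.2)
    rw [add_sub_sub_cancel, ← two_smul ℝ w, norm_smul]
    simpa using hw'
  have h := (convex_closedBall (0 : V) ‖z‖).norm_image_sub_le_of_norm_hasFDerivWithin_le hg hb
    (mem_closedBall_self (norm_nonneg z)) (show z ∈ closedBall (0 : V) ‖z‖ by simp)
  have hrel : meanDefect f x z = -(g z - g 0) / 2 := by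
    simp only [meanDefect, g, add_zero, sub_zero]
    ring
  rw [hrel, abs_div, abs_neg, abs_two, ← Real.norm_eq_abs]
  rw [sub_zero] at h
  linarith [show (K : ℝ) * (2 * ‖z‖) * ‖z‖ = 2 * (K * ‖z‖ ^ 2) by ring]

lemma integrable_meanDefect_div_rpow {n : ℕ} {σ : ℝ} (hσ : 0 < σ) (hσ1 : σ < 1)
    [Nonempty (Fin n)] {f : EuclideanSpace ℝ (Fin n) → ℝ} (hm : Measurable f)
    (hf : Integrable fun x => |f x| / (1 + ‖x‖) ^ ((n : ℝ) + 2 * σ))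
    {x : EuclideanSpace ℝ (Fin n)} (hx : ContDiffAt ℝ 2 f x) :
    Integrable fun z => meanDefect f x z / ‖z‖ ^ ((n : ℝ) + 2 * σ) := by
  obtain ⟨K, δ, hδ, hK⟩ := exists_abs_meanDefect_le hx
  have hγ : (n : ℝ) < n + 2 * σ := by linarith
  have hγ0 : (0 : ℝ) < n + 2 * σ := lt_of_le_of_lt n.cast_nonneg hγ
  have hmeas : Measurable fun z => meanDefect f x z / ‖z‖ ^ ((n : ℝ) + 2 * σ) := by
    unfold meanDefect
    fun_prop
  have hcover : ball (0 : EuclideanSpace ℝ (Fin n)) δ ∪ {z | δ / 2 < ‖z‖} = univ := by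
    ext z
    simp only [mem_union, mem_ball_zero_iff, mem_ofPred_eq, mem_univ, iff_true]
    rcases lt_or_ge ‖z‖ δ with h | h
    · exact Or.inl h
    · exact Or.inr (by linarith)
  rw [← integrableOn_univ, ← hcover]
  refine IntegrableOn.union ?_ ?_
  · have h := (integrableOn_fun_norm_addHaar (volume : Measure (EuclideanSpace ℝ (Fin n)))
      (f := fun y : ℝ => K * (y ^ 2 / y ^ ((n : ℝ) + 2 * σ))) (r := δ)).2 ?_
    · refine h.mono' hmeas.aestronglyMeasurable ?_
      filter_upwards [ae_restrict_mem measurableSet_ball] with z hz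
      rw [norm_div, Real.norm_eq_abs, Real.norm_of_nonneg (by positivity), ← mul_div_assoc]
      exact div_le_div_of_nonneg_right (hK z (by simpa using hz)) (by positivity)
    · rw [finrank_euclideanSpace_fin]
      have hpow : IntegrableOn (fun y : ℝ => K * y ^ (1 - 2 * σ)) (Ioo 0 δ) :=
        ((intervalIntegral.integrableOn_Ioo_rpow_iff hδ).2 (by linarith)).const_mul K
      refine hpow.congr_fun (fun y hy => ?_) measurableSet_Ioo
      have hy0 : 0 < y := hy.1
      have hn1 : 1 ≤ n := Fin.pos_iff_nonempty.2 ‹_›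
      simp only [smul_eq_mul]
      rw [← Real.rpow_natCast y (n - 1), Nat.cast_sub hn1, ← Real.rpow_natCast y 2,
        ← Real.rpow_sub hy0, mul_left_comm, ← Real.rpow_add hy0]
      congr 2
      push_cast
      ring
  · have h1 := integrableOn_shift_div_rpow hγ0 (half_pos hδ) hm hf x
    have h2 := integrableOn_shift_div_rpow hγ0 (half_pos hδ) (f := fun y => f (-y))
      (by fun_prop) (by simpa using hf.comp_neg) (-x)
    have h3 := (integrableOn_inv_rpow_norm (n := n) hγ (half_pos hδ)).const_mul (f x)
    refine (h3.sub ((h1.add h2).const_mul (1 / 2))).congr (ae_of_all _ fun z => ?_)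
    simp only [meanDefect, Pi.add_apply, Pi.sub_apply, neg_add, neg_neg, ← sub_eq_add_neg]
    ring

lemma integral_dist_eq_integral_meanDefect {n : ℕ} {γ ε : ℝ} (hγ : (n : ℝ) < γ) (hε : 0 < ε)
    {f : EuclideanSpace ℝ (Fin n) → ℝ} (hm : Measurable f)
    (hf : Integrable fun x => |f x| / (1 + ‖x‖) ^ γ) (x : EuclideanSpace ℝ (Fin n)) :
    ∫ ξ in {ξ : EuclideanSpace ℝ (Fin n) | ε < dist x ξ}, (f x - f ξ) / dist x ξ ^ γ =
      ∫ z in {z : EuclideanSpace ℝ (Fin n) | ε < ‖z‖}, meanDefect f x z / ‖z‖ ^ γ := by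
  have hset : MeasurableSet {z : EuclideanSpace ℝ (Fin n) | ε < ‖z‖} :=
    measurableSet_lt measurable_const measurable_norm
  have hset' : MeasurableSet {ξ : EuclideanSpace ℝ (Fin n) | ε < dist x ξ} :=
    measurableSet_lt measurable_const (measurable_const.dist measurable_id)
  let k : EuclideanSpace ℝ (Fin n) → ℝ := {z | ε < ‖z‖}.indicator fun z => (‖z‖ ^ γ)⁻¹
  have hk : ∀ z, k (-z) = k z := fun z => by simp [k, indicator]
  have hki : Integrable k := (integrable_indicator_iff hset).2 (integrableOn_inv_rpow_norm hγ hε)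
  have hfk : Integrable fun z => f (x + z) * k z := by
    have h := (integrable_indicator_iff hset).2
      (integrableOn_shift_div_rpow (lt_of_le_of_lt n.cast_nonneg hγ) hε hm hf x)
    refine h.congr (ae_of_all _ fun z => ?_)
    by_cases hz : ε < ‖z‖ <;> simp [k, indicator, hz, div_eq_mul_inv]
  have hR : ∫ z in {z : EuclideanSpace ℝ (Fin n) | ε < ‖z‖}, meanDefect f x z / ‖z‖ ^ γ =
      ∫ z, meanDefect f x z * k z := by
    rw [← integral_indicator hset]
    refine integral_congr_ae (ae_of_all _ fun z => ?_)
    by_cases hz : ε < ‖z‖ <;> simp [k, indicator, hz, div_eq_mul_inv]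
  have hL : ∫ ξ in {ξ : EuclideanSpace ℝ (Fin n) | ε < dist x ξ}, (f x - f ξ) / dist x ξ ^ γ =
      ∫ z, (f x * k z - f (x + z) * k z) := by
    rw [← integral_indicator hset', ← integral_add_left_eq_self _ x]
    refine integral_congr_ae (ae_of_all _ fun z => ?_)
    by_cases hz : ε < ‖z‖ <;> simp [k, indicator, hz, div_eq_mul_inv, sub_mul]
  rw [hL, hR, integral_meanDefect_mul_even hk hki hfk, integral_sub (hki.const_mul _) hfk,
    integral_const_mul]

lemma tendsto_integral_meanDefect {n : ℕ} {γ : ℝ}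
    {F : EuclideanSpace ℝ (Fin n) → ℝ} (hγ : 0 < γ)
    (hF : Integrable fun z => F z / ‖z‖ ^ γ) :
    Tendsto (fun ε : ℝ => ∫ z in {z : EuclideanSpace ℝ (Fin n) | ε < ‖z‖}, F z / ‖z‖ ^ γ)
      (𝓝[>] 0) (𝓝 (∫ z, F z / ‖z‖ ^ γ)) := by
  have hset : ∀ ε : ℝ, MeasurableSet {z : EuclideanSpace ℝ (Fin n) | ε < ‖z‖} := fun ε =>
    measurableSet_lt measurable_const measurable_norm
  simp_rw [← integral_indicator (hset _)]
  refine tendsto_integral_filter_of_dominated_convergence _ ?_ ?_ hF.norm ?_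
  · exact Eventually.of_forall fun ε => hF.aestronglyMeasurable.indicator (hset ε)
  · exact Eventually.of_forall fun ε => ae_of_all _ fun z => norm_indicator_le_norm_self _ _
  · refine ae_of_all _ fun z => tendsto_const_nhds.congr' ?_
    rcases eq_or_ne z 0 with rfl | hz
    · exact Eventually.of_forall fun ε => by simp [indicator, Real.zero_rpow hγ.ne']
    · filter_upwards [nhdsWithin_le_nhds (eventually_lt_nhds (norm_pos_iff.2 hz))] with ε hε
      simp [indicator, hε]

/-- **Lemma 4.2**: the explicit singular solution `|x|^{−(2σ+α)/(p−1)}` of the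
fractional Hardy–Hénon equation in `ℝⁿ \ {0}`. -/
theorem explicit_singular_solution
    (n : ℕ) (σ α p : ℝ) (hn : 2 ≤ n) (hσ : σ ∈ Set.Ioo (0 : ℝ) 1)
    (hα₁ : -(2 * σ) < α) (hα₂ : α < 2 * σ)
    (hp : ((n : ℝ) + α) / ((n : ℝ) - 2 * σ) < p)
    (u : EuclideanSpace ℝ (Fin n) → ℝ)
    (hu : u = fun x => ‖x‖ ^ (-((2 * σ + α) / (p - 1)))) :
    ContDiffOn ℝ 2 u ({0}ᶜ : Set (EuclideanSpace ℝ (Fin n))) ∧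
      MemLsigma n σ u ∧
      FracLapEq n σ u ({0}ᶜ : Set (EuclideanSpace ℝ (Fin n)))
        (fun x => Cpsa n σ p α ^ (p - 1) * (‖x‖ ^ α * u x ^ p)) := by
  obtain ⟨hσ0, hσ1⟩ := hσ
  have hn2 : (2 : ℝ) ≤ n := by exact_mod_cast hn
  have : Nonempty (Fin n) := Fin.pos_iff_nonempty.1 (by omega)
  have hd : 0 < (n : ℝ) - 2 * σ := by linarith
  rw [div_lt_iff₀ hd] at hp
  have hp1 : 0 < p - 1 := by
    by_contra! h
    nlinarith
  obtain ⟨κ, hκdef⟩ : ∃ κ, κ = (2 * σ + α) / (p - 1) / 2 := ⟨_, rfl⟩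
  have hθ : (2 * σ + α) / (p - 1) = 2 * κ := by linarith
  have hκ : 0 < κ := by
    rw [hκdef]
    have : 0 < 2 * σ + α := by linarith
    positivity
  have hmul : 2 * κ * (p - 1) = 2 * σ + α := by
    rw [← hθ, div_mul_cancel₀ _ hp1.ne']
  have hκn : σ + κ < (n : ℝ) / 2 := by
    have h : (2 * σ + α) / (p - 1) < n - 2 * σ := by
      rw [div_lt_iff₀ hp1]
      linarith
    linarith
  have hC : Cpsa n σ p α ^ (p - 1) = 2 ^ (2 * σ) *
      (Real.Gamma ((n : ℝ) / 2 - κ) * Real.Gamma (σ + κ)) /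
        (Real.Gamma κ * Real.Gamma ((n : ℝ) / 2 - (σ + κ))) := by
    have hL : Lam n σ (((n : ℝ) - 2 * σ) / 2 - (2 * σ + α) / (p - 1)) = 2 ^ (2 * σ) *
        (Real.Gamma ((n : ℝ) / 2 - κ) * Real.Gamma (σ + κ)) /
          (Real.Gamma κ * Real.Gamma ((n : ℝ) / 2 - (σ + κ))) := by
      rw [Lam, hθ]
      congr 4 <;> ring
    have h1 := Real.Gamma_pos_of_pos (show 0 < (n : ℝ) / 2 - κ by linarith)
    have h2 := Real.Gamma_pos_of_pos (show 0 < σ + κ by linarith)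
    have h3 := Real.Gamma_pos_of_pos hκ
    have h4 := Real.Gamma_pos_of_pos (show 0 < (n : ℝ) / 2 - (σ + κ) by linarith)
    rw [Cpsa, hL, ← Real.rpow_mul (by positivity), one_div_mul_cancel hp1.ne', Real.rpow_one]
  rw [hθ] at hu
  have hm : Measurable u := by
    rw [hu]
    fun_prop
  have hcd : ∀ x : EuclideanSpace ℝ (Fin n), x ≠ 0 → ContDiffAt ℝ 2 u x := by
    intro x hx
    rw [hu]
    exact (contDiffAt_norm ℝ hx).rpow_const_of_ne (norm_ne_zero_iff.2 hx)
  have hw : Integrable fun x => |u x| / (1 + ‖x‖) ^ ((n : ℝ) + 2 * σ) := by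
    rw [hu]
    exact integrable_weighted_rpow_norm hσ0 hκ (by linarith)
  refine ⟨fun x hx => (hcd x hx).contDiffWithinAt,
    ⟨locallyIntegrable_of_integrable_weighted hm hw, hw⟩, fun x hx => ?_⟩
  have hx : x ≠ 0 := hx
  have hx0 : 0 < ‖x‖ := norm_pos_iff.2 hx
  have hE := integrable_meanDefect_div_rpow hσ0 hσ1 hm hw (hcd x hx)
  have hlim := (tendsto_integral_meanDefect (by linarith) hE).const_mul (cns n σ)
  have hval : cns n σ * ∫ z, meanDefect u x z / ‖z‖ ^ ((n : ℝ) + 2 * σ) =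
      Cpsa n σ p α ^ (p - 1) * (‖x‖ ^ α * u x ^ p) := by
    have hpow : ‖x‖ ^ α * u x ^ p = ‖x‖ ^ (-(2 * (σ + κ))) := by
      rw [hu]
      simp only
      rw [← Real.rpow_mul hx0.le, ← Real.rpow_add hx0]
      congr 1
      linarith
    have hI := integral_meanDefect_rpow_norm hσ0 hσ1 hκ hκn hx (hu ▸ hE)
    rw [← hu] at hI
    have h1 := Real.Gamma_pos_of_pos (show 0 < (n : ℝ) / 2 + σ by linarith)
    have h2 := Real.Gamma_pos_of_pos (show 0 < 1 - σ by linarith)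
    have hπ : 0 < Real.pi ^ ((n : ℝ) / 2) := by positivity
    rw [hpow, hC, cns, show ((n : ℝ) + 2 * σ) / 2 = n / 2 + σ by ring,
      div_mul_eq_mul_div, mul_assoc, hI]
    field_simp
  rw [hval] at hlim
  refine hlim.congr' ?_
  filter_upwards [self_mem_nhdsWithin] with ε hε
  rw [integral_dist_eq_integral_meanDefect (by linarith) hε hm hw x]

end
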